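/- Let S be a finite set with |S| ≥ 2, let φ_s : ℝ → ℝ for each s ∈ S, and let Φ(u)_s = φ_s(u_s). Suppose NSD(X,S,Φ∘U) ⊆ NSD(X,S,U) for every nonempty finite X and every U : X × S → ℝ (or the same containment with NWD in place of NSD). Then each φ_s is strictly increasing. -/

import Mathlib

open Finset

def IsDist {X : Type} [Fintype X] (p : X → ℝ) : Prop :=
  (∀ x, 0 ≤ p x) ∧ (∑ x, p x) = 1

def NSD {X S : Type} [Fintype X] (S' : Set S) (U : X → S → ℝ) : Set X :=
  {x | ¬ ∃ p : X → ℝ, IsDist p ∧ ∀ s ∈ S', (∑ y, U y s * p y) > U x s}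

def NWD {X S : Type} [Fintype X] (S' : Set S) (U : X → S → ℝ) : Set X :=
  {x | ¬ ∃ p : X → ℝ, IsDist p ∧ (∀ s ∈ S', (∑ y, U y s * p y) ≥ U x s) ∧
      (∃ s ∈ S', (∑ y, U y s * p y) > U x s)}

def NSDhat {X S : Type} (S' : Set S) (U : X → S → ℝ) : Set X :=
  {x | ¬ ∃ y : X, ∀ s ∈ S', U y s > U x s}

def NWDhat {X S : Type} (S' : Set S) (U : X → S → ℝ) : Set X :=
  {x | ¬ ∃ y : X, (∀ s ∈ S', U y s ≥ U x s) ∧ (∃ s ∈ S', U y s > U x s)}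

theorem stmt9 {S : Type} [Fintype S] (hS : 2 ≤ Fintype.card S)
    (φ : S → ℝ → ℝ)
    (h : (∀ (X : Type) [Fintype X] [Nonempty X] (U : X → S → ℝ),
            NSD (Set.univ : Set S) (fun x s => φ s (U x s)) ⊆ NSD Set.univ U) ∨
         (∀ (X : Type) [Fintype X] [Nonempty X] (U : X → S → ℝ),
            NWD (Set.univ : Set S) (fun x s => φ s (U x s)) ⊆ NWD Set.univ U)) :
    ∀ s, StrictMono (φ s) := by
  classical
  intro s a b hab
  rcases h with h | h
  · by_contra hn
    have h1 := @h Bool _ _ (fun x _ => if x then b else a) false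
    simp only [NSD, Set.mem_setOf_eq, IsDist, Fintype.sum_bool] at h1
    refine h1 ?_ ⟨fun x => if x then 1 else 0, ⟨?_, by simp⟩, ?_⟩
    · rintro ⟨p, ⟨hp, hs⟩, hd⟩
      have h2 := hd s (Set.mem_univ s)
      simp only [if_true, Bool.false_eq_true, if_false] at h2
      have h3 := hp true
      have h4 : p false = 1 - p true := by linarith
      rw [h4] at h2
      nlinarith
    · intro x; cases x <;> simp
    · intro t _; simpa using hab
  · by_contra hn
    have h1 := @h Bool _ _ (fun x t => if x = true ∧ t = s then b else a) false
    simp only [NWD, Set.mem_setOf_eq, IsDist, Fintype.sum_bool] at h1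
    refine h1 ?_ ⟨fun x => if x then 1 else 0, ⟨?_, by simp⟩, ?_, s, Set.mem_univ s, ?_⟩
    · rintro ⟨p, ⟨hp, hs⟩, -, t, -, h2⟩
      have h3 := hp true
      have h4 : p false = 1 - p true := by linarith
      rw [h4] at h2
      by_cases hts : t = s
      · subst hts
        simp only [true_and, if_true, Bool.false_eq_true, false_and, if_false] at h2
        nlinarith
      · simp only [hts, and_false, if_false] at h2
        linarith
    · intro x; cases x <;> simp
    · intro t _
      by_cases hts : t = s
      · simpa [hts] using hab.le
      · simp [hts]
    · simpa using hab
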